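/- arXiv:2304.01272 — 4 statements merged into one kernel-verified Lean document; each statement's English description precedes it below -/
import Mathlib

section
/- Let X be an ℝ^d-valued Gaussian random vector with mean μ ∈ ℝ^d and symmetric positive definite covariance matrix Σ ∈ ℝ^{d×d}. Let M be a symmetric d×d real matrix such that Σ⁻¹ + M is positive definite, and let V ∈ ℝ^d. Set ν := (Σ⁻¹ + M)⁻¹ (V + Σ⁻¹ μ). Then the matrix-valued integral E[X Xᵀ · exp(-(1/2) Xᵀ M X + Xᵀ V)] is finite and equals ( (Σ⁻¹ + M)⁻¹ + ν νᵀ ) · E[exp(-(1/2) Xᵀ M X + Xᵀ V)]. -/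
open MeasureTheory ProbabilityTheory Matrix Filter

/-- The density of a `N(μ, S)` Gaussian on `ℝ^d` (with respect to Lebesgue measure). -/
noncomputable def gaussianPdf (d : ℕ) (μ : Fin d → ℝ) (S : Matrix (Fin d) (Fin d) ℝ)
    (x : Fin d → ℝ) : ℝ :=
  (Real.sqrt ((2 * Real.pi) ^ d * S.det))⁻¹ *
    Real.exp (-(1 / 2) * ((x - μ) ⬝ᵥ (S⁻¹ *ᵥ (x - μ))))

/-- `X` is a Gaussian random vector with mean `μ` and covariance matrix `S`. -/
def IsGaussianVec {Ω : Type*} [MeasurableSpace Ω] (P : Measure Ω) {d : ℕ}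
    (X : Ω → Fin d → ℝ) (μ : Fin d → ℝ) (S : Matrix (Fin d) (Fin d) ℝ) : Prop :=
  Measure.map X P = volume.withDensity fun x => ENNReal.ofReal (gaussianPdf d μ S x)

/-- A positive definite real matrix is congruent to the identity. -/
theorem Matrix.PosDef.exists_congr_one {n : Type*} [Fintype n] [DecidableEq n]
    {A : Matrix n n ℝ} (hA : A.PosDef) :
    ∃ L : Matrix n n ℝ, L.det ≠ 0 ∧ Lᵀ * A * L = 1 ∧ A⁻¹ = L * Lᵀ := by
  obtain ⟨B, hB⟩ : ∃ B : Matrix n n ℝ, A = Bᵀ * B := by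
    open scoped MatrixOrder Matrix.Norms.L2Operator in
    obtain ⟨B, hB⟩ := CStarAlgebra.nonneg_iff_eq_star_mul_self.mp hA.posSemidef.nonneg
    exact ⟨B, by rw [hB, star_eq_conjTranspose, conjTranspose_eq_transpose_of_trivial]⟩
  have hdet : B.det ≠ 0 := by
    have h := hA.det_pos.ne'
    rw [hB, det_mul] at h
    exact right_ne_zero_of_mul h
  have hu : IsUnit B.det := hdet.isUnit
  refine ⟨B⁻¹, ?_, ?_, ?_⟩
  · simpa [det_nonsing_inv] using hdet
  · rw [hB, Matrix.mul_assoc, Matrix.mul_assoc, mul_nonsing_inv _ hu, Matrix.mul_one,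
      ← transpose_mul, mul_nonsing_inv _ hu, transpose_one]
  · rw [hB, Matrix.mul_inv_rev, transpose_nonsing_inv]

theorem integrable_pow_mul_exp_neg_half_sq (n : ℕ) :
    Integrable (fun x : ℝ => x ^ n * Real.exp (-(1 / 2) * x ^ 2)) := by
  have h := integrable_rpow_mul_exp_neg_mul_sq (b := 1 / 2) (by norm_num) (s := n)
    (by linarith [(Nat.cast_nonneg n : (0 : ℝ) ≤ n)])
  simpa only [Real.rpow_natCast] using h

theorem integral_mul_exp_neg_half_sq :
    ∫ x : ℝ, x ^ 1 * Real.exp (-(1 / 2) * x ^ 2) = 0 := by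
  have h := integral_neg_eq_self (fun x : ℝ => x ^ 1 * Real.exp (-(1 / 2) * x ^ 2)) volume
  simp only [pow_one, neg_sq, neg_mul _ (Real.exp _), integral_neg] at h ⊢
  linarith

theorem integral_sq_mul_exp_neg_half_sq :
    ∫ x : ℝ, x ^ 2 * Real.exp (-(1 / 2) * x ^ 2) =
      ∫ x : ℝ, x ^ 0 * Real.exp (-(1 / 2) * x ^ 2) := by
  have hi := integrable_pow_mul_exp_neg_half_sq
  have h := integral_mul_deriv_eq_deriv_mul_of_integrable
    (u := fun x : ℝ => x) (u' := fun _ => 1)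
    (v := fun x : ℝ => -Real.exp (-(1 / 2) * x ^ 2))
    (v' := fun x : ℝ => x * Real.exp (-(1 / 2) * x ^ 2))
    (fun x _ => hasDerivAt_id x)
    (fun x _ => by
      refine (((hasDerivAt_pow 2 x).const_mul (-(1 / 2) : ℝ)).exp).neg.congr_deriv ?_
      push_cast
      ring)
    ((hi 2).congr (.of_forall fun x => by simp only [Pi.mul_apply]; ring))
    ((hi 0).neg.congr (.of_forall fun x => by simp))
    ((hi 1).neg.congr (.of_forall fun x => by simp))
  simp only [one_mul, integral_neg, neg_neg] at h
  simp only [pow_zero, one_mul, ← h]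
  exact integral_congr_ae (.of_forall fun x => by ring)

/-- Monomials against the (unnormalised) standard Gaussian weight factor over the coordinates. -/
theorem prod_pow_mul_exp_neg_half_dotProduct {ι : Type*} [Fintype ι] (p : ι → ℕ) (y : ι → ℝ) :
    ∏ m, (y m ^ p m * Real.exp (-(1 / 2) * y m ^ 2)) =
      (∏ m, y m ^ p m) * Real.exp (-(1 / 2) * (y ⬝ᵥ y)) := by
  rw [Finset.prod_mul_distrib, ← Real.exp_sum, ← Finset.mul_sum]
  simp only [dotProduct, sq]

theorem integrable_prod_pow_mul_exp {ι : Type*} [Fintype ι] (p : ι → ℕ) :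
    Integrable (fun y : ι → ℝ => (∏ m, y m ^ p m) * Real.exp (-(1 / 2) * (y ⬝ᵥ y))) := by
  simp only [← prod_pow_mul_exp_neg_half_dotProduct]
  exact Integrable.fintype_prod (f := fun m (x : ℝ) => x ^ p m * Real.exp (-(1 / 2) * x ^ 2))
    fun m => integrable_pow_mul_exp_neg_half_sq (p m)

theorem integral_prod_pow_mul_exp {ι : Type*} [Fintype ι] (p : ι → ℕ) :
    ∫ y : ι → ℝ, (∏ m, y m ^ p m) * Real.exp (-(1 / 2) * (y ⬝ᵥ y)) =
      ∏ m, ∫ x : ℝ, x ^ p m * Real.exp (-(1 / 2) * x ^ 2) := by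
  simp only [← prod_pow_mul_exp_neg_half_dotProduct]
  exact integral_fintype_prod_volume_eq_prod
    (fun m (x : ℝ) => x ^ p m * Real.exp (-(1 / 2) * x ^ 2))

theorem integrable_exp_neg_half_dotProduct {ι : Type*} [Fintype ι] :
    Integrable (fun y : ι → ℝ => Real.exp (-(1 / 2) * (y ⬝ᵥ y))) := by
  simpa using integrable_prod_pow_mul_exp (fun _ : ι => 0)

section Moments

variable {ι : Type*} [Fintype ι] [DecidableEq ι]

theorem prod_pow_single (k : ι) (y : ι → ℝ) :
    ∏ m, y m ^ (Pi.single k 1 : ι → ℕ) m = y k := by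
  rw [Finset.prod_eq_single k] <;> simp +contextual

theorem prod_pow_single_add_single (k l : ι) (y : ι → ℝ) :
    ∏ m, y m ^ (Pi.single k 1 + Pi.single l 1 : ι → ℕ) m = y k * y l := by
  simp only [Pi.add_apply, pow_add, Finset.prod_mul_distrib, prod_pow_single]

theorem integrable_coord_mul_exp (k : ι) :
    Integrable (fun y : ι → ℝ => y k * Real.exp (-(1 / 2) * (y ⬝ᵥ y))) := by
  simpa only [prod_pow_single] using integrable_prod_pow_mul_exp (Pi.single k 1 : ι → ℕ)

theorem integral_coord_mul_exp (k : ι) :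
    ∫ y : ι → ℝ, y k * Real.exp (-(1 / 2) * (y ⬝ᵥ y)) = 0 := by
  have h := integral_prod_pow_mul_exp (Pi.single k 1 : ι → ℕ)
  simp only [prod_pow_single] at h
  rw [h]
  refine Finset.prod_eq_zero (Finset.mem_univ k) ?_
  rw [Pi.single_eq_same, integral_mul_exp_neg_half_sq]

theorem integrable_coord_mul_coord_mul_exp (k l : ι) :
    Integrable (fun y : ι → ℝ => y k * y l * Real.exp (-(1 / 2) * (y ⬝ᵥ y))) := by
  have h := integrable_prod_pow_mul_exp (Pi.single k 1 + Pi.single l 1 : ι → ℕ)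
  simp only [prod_pow_single_add_single] at h
  exact h

theorem integral_coord_mul_coord_mul_exp (k l : ι) :
    ∫ y : ι → ℝ, y k * y l * Real.exp (-(1 / 2) * (y ⬝ᵥ y)) =
      (1 : Matrix ι ι ℝ) k l * ∫ y : ι → ℝ, Real.exp (-(1 / 2) * (y ⬝ᵥ y)) := by
  have h := integral_prod_pow_mul_exp (Pi.single k 1 + Pi.single l 1 : ι → ℕ)
  simp only [prod_pow_single_add_single] at h
  rw [h]
  by_cases hkl : k = l
  · subst hkl
    have h0 := integral_prod_pow_mul_exp (fun _ : ι => 0)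
    simp only [pow_zero, Finset.prod_const_one, one_mul] at h0
    rw [h0, one_apply_eq, one_mul]
    refine Finset.prod_congr rfl fun m _ => ?_
    by_cases hm : m = k
    · subst hm
      simpa using integral_sq_mul_exp_neg_half_sq
    · simp [hm]
  · rw [one_apply_ne hkl, zero_mul]
    refine Finset.prod_eq_zero (Finset.mem_univ k) ?_
    have hk : (Pi.single k 1 + Pi.single l 1 : ι → ℕ) k = 1 := by simp [hkl]
    rw [hk, integral_mul_exp_neg_half_sq]

theorem volume_eq_smul_map_affine {L : Matrix ι ι ℝ} (hL : L.det ≠ 0) (ν : ι → ℝ) :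
    (volume : Measure (ι → ℝ)) =
      ENNReal.ofReal |L.det| • Measure.map (fun y => ν + L *ᵥ y) volume := by
  have hmap : Measure.map (fun y => ν + L *ᵥ y) volume =
      ENNReal.ofReal |L.det⁻¹| • (volume : Measure (ι → ℝ)) := by
    have hc : Measurable (toLin' L) := (toLin' L).continuous_of_finiteDimensional.measurable
    have : (fun y => ν + L *ᵥ y) = (fun x => ν + x) ∘ toLin' L := by
      ext y; simp
    rw [this, ← Measure.map_map (measurable_const_add ν) hc,
      Real.map_matrix_volume_pi_eq_smul_volume_pi hL, Measure.map_smul, map_add_left_eq_self]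
  rw [hmap, smul_smul, ← ENNReal.ofReal_mul (abs_nonneg _), ← abs_mul, mul_inv_cancel₀ hL]
  simp

theorem integrable_of_comp_affine {L : Matrix ι ι ℝ} (hL : L.det ≠ 0) (ν : ι → ℝ)
    {f : (ι → ℝ) → ℝ} (hf : Continuous f) (h : Integrable fun y => f (ν + L *ᵥ y)) :
    Integrable f := by
  rw [volume_eq_smul_map_affine hL ν]
  refine Integrable.smul_measure ?_ ENNReal.ofReal_ne_top
  exact (integrable_map_measure hf.aestronglyMeasurable
    (by fun_prop : Continuous fun y => ν + L *ᵥ y).aemeasurable).2 h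

theorem integral_eq_abs_det_mul_integral_comp_affine {L : Matrix ι ι ℝ} (hL : L.det ≠ 0)
    (ν : ι → ℝ) {f : (ι → ℝ) → ℝ} (hf : Continuous f) :
    ∫ x, f x = |L.det| * ∫ y, f (ν + L *ᵥ y) := by
  conv_lhs => rw [volume_eq_smul_map_affine hL ν]
  rw [integral_smul_measure, ENNReal.toReal_ofReal (abs_nonneg _), smul_eq_mul,
    integral_map (by fun_prop : Continuous fun y => ν + L *ᵥ y).aemeasurable
      hf.aestronglyMeasurable]

/-- Second moments of an affine image under the unnormalised standard Gaussian weight. -/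
theorem second_moment_affine_exp (L : Matrix ι ι ℝ) (ν : ι → ℝ) (i j : ι) :
    Integrable (fun y : ι → ℝ =>
      (ν + L *ᵥ y) i * (ν + L *ᵥ y) j * Real.exp (-(1 / 2) * (y ⬝ᵥ y))) ∧
    ∫ y : ι → ℝ, (ν + L *ᵥ y) i * (ν + L *ᵥ y) j * Real.exp (-(1 / 2) * (y ⬝ᵥ y)) =
      (L * Lᵀ + vecMulVec ν ν) i j * ∫ y : ι → ℝ, Real.exp (-(1 / 2) * (y ⬝ᵥ y)) := by
  have hexp : (fun y : ι → ℝ =>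
      (ν + L *ᵥ y) i * (ν + L *ᵥ y) j * Real.exp (-(1 / 2) * (y ⬝ᵥ y))) = fun y =>
      (ν i * ν j * Real.exp (-(1 / 2) * (y ⬝ᵥ y)) +
        ∑ k, (ν i * L j k + ν j * L i k) * (y k * Real.exp (-(1 / 2) * (y ⬝ᵥ y)))) +
      ∑ k, ∑ l, L i k * L j l * (y k * y l * Real.exp (-(1 / 2) * (y ⬝ᵥ y))) := by
    ext y
    have h2 : ∑ k, ∑ l, L i k * L j l * (y k * y l * Real.exp (-(1 / 2) * (y ⬝ᵥ y))) =
        (L *ᵥ y) i * (L *ᵥ y) j * Real.exp (-(1 / 2) * (y ⬝ᵥ y)) := by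
      generalize Real.exp (-(1 / 2) * (y ⬝ᵥ y)) = φ
      simp only [mulVec, dotProduct]
      rw [Finset.sum_mul_sum]
      simp only [Finset.sum_mul]
      exact Finset.sum_congr rfl fun k _ => Finset.sum_congr rfl fun l _ => by ring
    have h1 : ∑ k, (ν i * L j k + ν j * L i k) * (y k * Real.exp (-(1 / 2) * (y ⬝ᵥ y))) =
        (ν i * (L *ᵥ y) j + ν j * (L *ᵥ y) i) * Real.exp (-(1 / 2) * (y ⬝ᵥ y)) := by
      simp only [mulVec, dotProduct, Finset.mul_sum, ← Finset.sum_add_distrib, Finset.sum_mul]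
      exact Finset.sum_congr rfl fun k _ => by ring
    rw [h1, h2, Pi.add_apply, Pi.add_apply]
    ring
  have i0 := (integrable_exp_neg_half_dotProduct (ι := ι)).const_mul (ν i * ν j)
  have i1 (k : ι) := (integrable_coord_mul_exp k).const_mul (ν i * L j k + ν j * L i k)
  have i2 (k l : ι) := (integrable_coord_mul_coord_mul_exp k l).const_mul (L i k * L j l)
  have s1 := integrable_finsetSum Finset.univ fun k _ => i1 k
  have s2 (k : ι) := integrable_finsetSum Finset.univ fun l _ => i2 k l
  have s3 := integrable_finsetSum Finset.univ fun k _ => s2 k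
  have s01 : Integrable fun y : ι → ℝ => ν i * ν j * Real.exp (-(1 / 2) * (y ⬝ᵥ y)) +
      ∑ k, (ν i * L j k + ν j * L i k) * (y k * Real.exp (-(1 / 2) * (y ⬝ᵥ y))) := i0.add s1
  rw [hexp]
  refine ⟨s01.add s3, ?_⟩
  rw [integral_add s01 s3, integral_add i0 s1, integral_finsetSum _ fun k _ => i1 k,
    integral_finsetSum _ fun k _ => s2 k]
  simp only [integral_finsetSum _ fun l _ => i2 _ l, integral_const_mul, integral_coord_mul_exp,
    integral_coord_mul_coord_mul_exp, mul_zero, Finset.sum_const_zero, add_zero]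
  simp only [Matrix.add_apply, vecMulVec_apply, Matrix.mul_apply, transpose_apply, one_apply,
    ite_mul, one_mul, zero_mul, mul_ite, mul_zero, Finset.sum_ite_eq, Finset.mem_univ, if_true,
    add_mul, Finset.sum_mul]
  ring

theorem second_moment_exp_neg_half_quadratic {A : Matrix ι ι ℝ} (hA : A.PosDef) (ν : ι → ℝ)
    (i j : ι) :
    Integrable (fun x : ι → ℝ =>
      x i * x j * Real.exp (-(1 / 2) * ((x - ν) ⬝ᵥ (A *ᵥ (x - ν))))) ∧
    ∫ x : ι → ℝ, x i * x j * Real.exp (-(1 / 2) * ((x - ν) ⬝ᵥ (A *ᵥ (x - ν)))) =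
      (A⁻¹ + vecMulVec ν ν) i j *
        ∫ x : ι → ℝ, Real.exp (-(1 / 2) * ((x - ν) ⬝ᵥ (A *ᵥ (x - ν)))) := by
  obtain ⟨L, hL, hLA, hAinv⟩ := hA.exists_congr_one
  have hq (y : ι → ℝ) : (ν + L *ᵥ y - ν) ⬝ᵥ (A *ᵥ (ν + L *ᵥ y - ν)) = y ⬝ᵥ y := by
    rw [add_sub_cancel_left, mulVec_mulVec, ← vecMul_transpose, ← dotProduct_mulVec,
      mulVec_mulVec, ← Matrix.mul_assoc, hLA, one_mulVec]
  have hg : Continuous fun x : ι → ℝ => Real.exp (-(1 / 2) * ((x - ν) ⬝ᵥ (A *ᵥ (x - ν)))) := by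
    fun_prop
  have hf : Continuous fun x : ι → ℝ =>
      x i * x j * Real.exp (-(1 / 2) * ((x - ν) ⬝ᵥ (A *ᵥ (x - ν)))) := by
    fun_prop
  obtain ⟨hint, heq⟩ := second_moment_affine_exp L ν i j
  constructor
  · refine integrable_of_comp_affine hL ν hf ?_
    simpa only [hq] using hint
  · rw [integral_eq_abs_det_mul_integral_comp_affine hL ν hf,
      integral_eq_abs_det_mul_integral_comp_affine hL ν hg]
    simp only [hq]
    rw [heq, hAinv]
    ring

/-- Completing the square. -/
theorem complete_square {B M : Matrix ι ι ℝ} (hB : B.IsSymm) (hM : M.IsSymm)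
    (hBM : IsUnit (B + M).det) (μ V ν x : ι → ℝ) (hν : ν = (B + M)⁻¹ *ᵥ (V + B *ᵥ μ)) :
    -(1 / 2) * ((x - μ) ⬝ᵥ (B *ᵥ (x - μ))) + (-(1 / 2) * (x ⬝ᵥ (M *ᵥ x)) + x ⬝ᵥ V) =
      (1 / 2) * (ν ⬝ᵥ ((B + M) *ᵥ ν) - μ ⬝ᵥ (B *ᵥ μ)) +
        -(1 / 2) * ((x - ν) ⬝ᵥ ((B + M) *ᵥ (x - ν))) := by
  have hsymm {A : Matrix ι ι ℝ} (hA : A.IsSymm) (u v : ι → ℝ) :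
      u ⬝ᵥ (A *ᵥ v) = v ⬝ᵥ (A *ᵥ u) := by
    rw [dotProduct_mulVec, dotProduct_comm, ← mulVec_transpose, hA.eq]
  have h1 : (B + M) *ᵥ ν = V + B *ᵥ μ := by
    rw [hν, mulVec_mulVec, mul_nonsing_inv _ hBM, one_mulVec]
  have hx : x ⬝ᵥ ((B + M) *ᵥ ν) = x ⬝ᵥ V + x ⬝ᵥ (B *ᵥ μ) := by rw [h1, dotProduct_add]
  have hx' := hsymm (hB.add hM) ν x
  have hμ := hsymm hB μ x
  have hadd : x ⬝ᵥ ((B + M) *ᵥ x) = x ⬝ᵥ (B *ᵥ x) + x ⬝ᵥ (M *ᵥ x) := by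
    rw [add_mulVec, dotProduct_add]
  simp only [mulVec_sub, dotProduct_sub, sub_dotProduct]
  linarith

end Moments

theorem IsGaussianVec.integrable_comp_iff {Ω : Type*} [MeasurableSpace Ω] {P : Measure Ω} {d : ℕ}
    {X : Ω → Fin d → ℝ} {μ : Fin d → ℝ} {S : Matrix (Fin d) (Fin d) ℝ}
    (h : IsGaussianVec P X μ S) (hX : Measurable X) {f : (Fin d → ℝ) → ℝ} (hf : Continuous f) :
    Integrable (fun ω => f (X ω)) P ↔ Integrable fun x => gaussianPdf d μ S x * f x := by
  have hm : Continuous (gaussianPdf d μ S) := by unfold gaussianPdf; fun_prop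
  have h0 (x) : 0 ≤ gaussianPdf d μ S x := by unfold gaussianPdf; positivity
  have e := integrable_map_measure (μ := P) hf.aestronglyMeasurable hX.aemeasurable
  rw [h, integrable_withDensity_iff_integrable_smul' hm.measurable.ennreal_ofReal
    (.of_forall fun _ => ENNReal.ofReal_lt_top)] at e
  simp only [ENNReal.toReal_ofReal (h0 _), smul_eq_mul] at e
  exact e.symm

theorem IsGaussianVec.integral_comp {Ω : Type*} [MeasurableSpace Ω] {P : Measure Ω} {d : ℕ}
    {X : Ω → Fin d → ℝ} {μ : Fin d → ℝ} {S : Matrix (Fin d) (Fin d) ℝ}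
    (h : IsGaussianVec P X μ S) (hX : Measurable X) {f : (Fin d → ℝ) → ℝ} (hf : Continuous f) :
    ∫ ω, f (X ω) ∂P = ∫ x, gaussianPdf d μ S x * f x := by
  have hm : Continuous (gaussianPdf d μ S) := by unfold gaussianPdf; fun_prop
  have h0 (x) : 0 ≤ gaussianPdf d μ S x := by unfold gaussianPdf; positivity
  rw [← integral_map hX.aemeasurable hf.aestronglyMeasurable, h,
    integral_withDensity_eq_integral_toReal_smul hm.measurable.ennreal_ofReal
    (.of_forall fun _ => ENNReal.ofReal_lt_top)]
  simp only [ENNReal.toReal_ofReal (h0 _), smul_eq_mul]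

/-- Second exponential-quadratic Gaussian moment (stated entrywise): with
`ν := (Σ⁻¹+M)⁻¹(V+Σ⁻¹μ)`,
`E[XXᵀ exp(-(1/2)XᵀMX + XᵀV)] = ((Σ⁻¹+M)⁻¹ + ννᵀ) · E[exp(-(1/2)XᵀMX + XᵀV)]`. -/
theorem stmt_2 {Ω : Type*} [MeasurableSpace Ω] (P : Measure Ω) [IsProbabilityMeasure P]
    (d : ℕ) (X : Ω → Fin d → ℝ) (hX : Measurable X)
    (μ : Fin d → ℝ) (S M : Matrix (Fin d) (Fin d) ℝ) (V : Fin d → ℝ)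
    (hS : S.PosDef) (hMsymm : M.IsSymm) (hSM : (S⁻¹ + M).PosDef)
    (hGauss : IsGaussianVec P X μ S) (ν : Fin d → ℝ)
    (hν : ν = (S⁻¹ + M)⁻¹ *ᵥ (V + S⁻¹ *ᵥ μ)) :
    ∀ i j : Fin d,
      Integrable (fun ω => X ω i * X ω j *
        Real.exp (-(1 / 2) * (X ω ⬝ᵥ (M *ᵥ X ω)) + X ω ⬝ᵥ V)) P ∧
      ∫ ω, X ω i * X ω j * Real.exp (-(1 / 2) * (X ω ⬝ᵥ (M *ᵥ X ω)) + X ω ⬝ᵥ V) ∂P =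
        ((S⁻¹ + M)⁻¹ + Matrix.vecMulVec ν ν) i j *
          ∫ ω, Real.exp (-(1 / 2) * (X ω ⬝ᵥ (M *ᵥ X ω)) + X ω ⬝ᵥ V) ∂P := by
  intro i j
  have hBsymm : (S⁻¹).IsSymm := by
    have h := hS.inv.isHermitian
    rwa [IsHermitian, conjTranspose_eq_transpose_of_trivial] at h
  have hsq := fun x => complete_square hBsymm hMsymm hSM.det_pos.ne'.isUnit μ V ν x hν
  obtain ⟨K, hK⟩ : ∃ K : ℝ, ∀ x, gaussianPdf d μ S x *
      Real.exp (-(1 / 2) * (x ⬝ᵥ (M *ᵥ x)) + x ⬝ᵥ V) =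
      K * Real.exp (-(1 / 2) * ((x - ν) ⬝ᵥ ((S⁻¹ + M) *ᵥ (x - ν)))) := by
    refine ⟨(Real.sqrt ((2 * Real.pi) ^ d * S.det))⁻¹ *
      Real.exp ((1 / 2) * (ν ⬝ᵥ ((S⁻¹ + M) *ᵥ ν) - μ ⬝ᵥ (S⁻¹ *ᵥ μ))), fun x => ?_⟩
    rw [gaussianPdf, mul_assoc, ← Real.exp_add, hsq, Real.exp_add, mul_assoc]
  have hK2 (x : Fin d → ℝ) : gaussianPdf d μ S x *
      (x i * x j * Real.exp (-(1 / 2) * (x ⬝ᵥ (M *ᵥ x)) + x ⬝ᵥ V)) =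
      K * (x i * x j * Real.exp (-(1 / 2) * ((x - ν) ⬝ᵥ ((S⁻¹ + M) *ᵥ (x - ν))))) := by
    rw [mul_left_comm, hK, mul_left_comm]
  have hg : Continuous fun x : Fin d → ℝ =>
      Real.exp (-(1 / 2) * (x ⬝ᵥ (M *ᵥ x)) + x ⬝ᵥ V) := by fun_prop
  have hf : Continuous fun x : Fin d → ℝ =>
      x i * x j * Real.exp (-(1 / 2) * (x ⬝ᵥ (M *ᵥ x)) + x ⬝ᵥ V) := by fun_prop
  obtain ⟨hint, heq⟩ := second_moment_exp_neg_half_quadratic hSM ν i j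
  constructor
  · rw [hGauss.integrable_comp_iff hX hf]
    simpa only [hK2] using hint.const_mul K
  · rw [hGauss.integral_comp hX hf, hGauss.integral_comp hX hg]
    simp only [hK2, hK, integral_const_mul]
    rw [heq]
    ring
end

section
/- Let H be an ℝ^d-valued Gaussian random vector with mean μ_H and symmetric positive definite covariance Σ_H. Let M be an invertible d×d real matrix, V ∈ ℝ^d, and define the terminal asset price S := M H + V. Let γ > 0, let M̄ be a symmetric d×d matrix such that Σ_H⁻¹ + M̄ is positive definite, let V̄ ∈ ℝ^d and λ̄ ∈ ℝ, and define the random endowment ℰ := (1/γ)( (1/2) Hᵀ M̄ H + Hᵀ V̄ + λ̄ ). Then for every price p ∈ ℝ^d the function π ↦ E[exp(-γ (πᵀ(S - p) + ℰ))] is finite on all of ℝ^d and attains a unique global minimum over ℝ^d at π̂ = (1/γ) (Mᵀ)⁻¹ ( Σ_H⁻¹ μ_H - V̄ + (Σ_H⁻¹ + M̄) M⁻¹ (V - p) ). -/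
open MeasureTheory ProbabilityTheory Matrix Filter

/-- The exponential disutility `exp(-γ(πᵀ(S - p) + ℰ))` of position `π` at price `p` for a
CARA agent with risk aversion `γ` and endowment `ℰ = (1/γ)((1/2)HᵀM̄H + HᵀV̄ + λ̄)`, where the
asset payoff is `S = MH + V`. -/
noncomputable def expDisutility {Ω : Type*} {d : ℕ} (H : Ω → Fin d → ℝ)
    (M : Matrix (Fin d) (Fin d) ℝ) (V : Fin d → ℝ) (γ : ℝ)
    (Mb : Matrix (Fin d) (Fin d) ℝ) (Vb : Fin d → ℝ) (lb : ℝ)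
    (p π : Fin d → ℝ) (ω : Ω) : ℝ :=
  Real.exp (-γ * (π ⬝ᵥ ((M *ᵥ H ω + V) - p) +
    (1 / γ) * ((1 / 2) * (H ω ⬝ᵥ (Mb *ᵥ H ω)) + H ω ⬝ᵥ Vb + lb)))

namespace Matrix

lemma PosDef.isSymm {n : Type*} {A : Matrix n n ℝ} (hA : A.PosDef) : A.IsSymm :=
  (conjTranspose_eq_transpose_of_trivial A).symm.trans hA.isHermitian

variable {n : Type*} [Fintype n]

/-- The bilinear form of a symmetric real matrix is symmetric. -/
lemma IsSymm.dotProduct_mulVec_comm {A : Matrix n n ℝ} (hA : A.IsSymm) (x y : n → ℝ) :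
    x ⬝ᵥ (A *ᵥ y) = y ⬝ᵥ (A *ᵥ x) := by
  rw [dotProduct_mulVec, ← mulVec_transpose, hA.eq, dotProduct_comm]

lemma IsSymm.quadForm_sub {A : Matrix n n ℝ} (hA : A.IsSymm) (x y : n → ℝ) :
    (x - y) ⬝ᵥ (A *ᵥ (x - y)) = x ⬝ᵥ (A *ᵥ x) - 2 * (x ⬝ᵥ (A *ᵥ y)) + y ⬝ᵥ (A *ᵥ y) := by
  rw [mulVec_sub, sub_dotProduct, dotProduct_sub, dotProduct_sub, hA.dotProduct_mulVec_comm y x]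
  ring

open scoped MatrixOrder in
lemma PosDef.integrable_exp_neg_quadForm [DecidableEq n] {A : Matrix n n ℝ} (hA : A.PosDef) :
    Integrable (fun x : n → ℝ => Real.exp (-(1 / 2) * (x ⬝ᵥ (A *ᵥ x)))) := by
  obtain ⟨B, rfl⟩ := CStarAlgebra.nonneg_iff_eq_star_mul_self.mp hA.posSemidef.nonneg
  have hdet : B.det ≠ 0 := by
    have h := hA.det_pos.ne'
    rw [det_mul] at h
    exact right_ne_zero_of_mul h
  have hprod : Integrable (fun x : n → ℝ => ∏ i, Real.exp (-(1 / 2) * x i ^ 2)) :=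
    Integrable.fintype_prod (f := fun _ t => Real.exp (-(1 / 2) * t ^ 2))
      fun _ => integrable_exp_neg_mul_sq (by norm_num)
  have hmap : Integrable (fun x : n → ℝ => ∏ i, Real.exp (-(1 / 2) * x i ^ 2))
      (Measure.map (toLin' B) volume) := by
    rw [Real.map_matrix_volume_pi_eq_smul_volume_pi hdet]
    exact hprod.smul_measure ENNReal.ofReal_ne_top
  refine (hmap.comp_measurable (toLin' B).continuous_of_finiteDimensional.measurable).congr
    (ae_of_all _ fun x => ?_)
  have hquad : x ⬝ᵥ ((star B * B) *ᵥ x) = ∑ i, (B *ᵥ x) i ^ 2 := by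
    rw [← mulVec_mulVec, dotProduct_mulVec, star_eq_conjTranspose,
      conjTranspose_eq_transpose_of_trivial, vecMul_transpose]
    simp [dotProduct, sq]
  simp only [Function.comp_apply, toLin'_apply, ← Real.exp_sum, ← Finset.mul_sum, hquad]

end Matrix

lemma measurable_gaussianPdf (d : ℕ) (μ : Fin d → ℝ) (S : Matrix (Fin d) (Fin d) ℝ) :
    Measurable (gaussianPdf d μ S) := by
  have : Continuous (gaussianPdf d μ S) := by
    unfold gaussianPdf
    fun_prop
  exact this.measurable

lemma gaussianPdf_nonneg (d : ℕ) (μ : Fin d → ℝ) (S : Matrix (Fin d) (Fin d) ℝ)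
    (x : Fin d → ℝ) : 0 ≤ gaussianPdf d μ S x := by
  unfold gaussianPdf
  positivity

namespace IsGaussianVec

variable {Ω : Type*} [MeasurableSpace Ω] {P : Measure Ω} {d : ℕ} {X : Ω → Fin d → ℝ}
  {μ : Fin d → ℝ} {S : Matrix (Fin d) (Fin d) ℝ} {f : (Fin d → ℝ) → ℝ}

lemma integrable_comp_iff_s3 (hG : IsGaussianVec P X μ S) (hX : Measurable X) (hf : Measurable f) :
    Integrable (fun ω => f (X ω)) P ↔ Integrable fun x => gaussianPdf d μ S x * f x := by
  have h := integrable_map_measure (μ := P) (g := f) hf.aestronglyMeasurable hX.aemeasurable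
  rw [hG, integrable_withDensity_iff_integrable_smul'
    (measurable_gaussianPdf d μ S).ennreal_ofReal (by simp)] at h
  simpa [ENNReal.toReal_ofReal, gaussianPdf_nonneg, Function.comp_def] using h.symm

lemma integral_comp_s3 (hG : IsGaussianVec P X μ S) (hX : Measurable X) (hf : Measurable f) :
    ∫ ω, f (X ω) ∂P = ∫ x, gaussianPdf d μ S x * f x := by
  rw [← integral_map hX.aemeasurable hf.aestronglyMeasurable, hG,
    integral_withDensity_eq_integral_toReal_smul
      (measurable_gaussianPdf d μ S).ennreal_ofReal (by simp)]
  simp [ENNReal.toReal_ofReal, gaussianPdf_nonneg]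

end IsGaussianVec

section ExpDisutility

variable {Ω : Type*} {d : ℕ} (M : Matrix (Fin d) (Fin d) ℝ)
  (V : Fin d → ℝ) {γ : ℝ} (Mb : Matrix (Fin d) (Fin d) ℝ) (Vb : Fin d → ℝ) (lb : ℝ)
  (p π : Fin d → ℝ)

lemma measurable_expDisutility_id (γ : ℝ) :
    Measurable (expDisutility id M V γ Mb Vb lb p π) := by
  have : Continuous (expDisutility id M V γ Mb Vb lb p π) := by
    unfold expDisutility
    simp only [id_eq]
    fun_prop
  exact this.measurable

/-- Completing the square in the product of the Gaussian density and the disutility. -/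
lemma gaussianPdf_mul_expDisutility (hγ : γ ≠ 0) {μ : Fin d → ℝ}
    {S : Matrix (Fin d) (Fin d) ℝ} (hS : S⁻¹.IsSymm) (hA : (S⁻¹ + Mb).IsSymm) {m : Fin d → ℝ}
    (hm : (S⁻¹ + Mb) *ᵥ m = S⁻¹ *ᵥ μ - γ • (Mᵀ *ᵥ π) - Vb) (x : Fin d → ℝ) :
    gaussianPdf d μ S x * expDisutility id M V γ Mb Vb lb p π x =
      ((Real.sqrt ((2 * Real.pi) ^ d * S.det))⁻¹ *
        Real.exp ((1 / 2) * (m ⬝ᵥ ((S⁻¹ + Mb) *ᵥ m)) - γ * (π ⬝ᵥ (V - p)) - lb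
          - (1 / 2) * (μ ⬝ᵥ (S⁻¹ *ᵥ μ)))) *
        Real.exp (-(1 / 2) * ((x - m) ⬝ᵥ ((S⁻¹ + Mb) *ᵥ (x - m)))) := by
  unfold gaussianPdf expDisutility
  rw [mul_assoc, mul_assoc, ← Real.exp_add, ← Real.exp_add]
  congr 2
  have hadj : x ⬝ᵥ (Mᵀ *ᵥ π) = π ⬝ᵥ (M *ᵥ x) := by
    rw [dotProduct_mulVec, vecMul_transpose, dotProduct_comm]
  rw [hS.quadForm_sub, hA.quadForm_sub, hm]
  simp only [id_eq, add_mulVec, dotProduct_add, dotProduct_sub, dotProduct_smul, smul_eq_mul, hadj]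
  field_simp
  ring

end ExpDisutility

/-- Single-agent CARA optimum: for every price `p` the map
`π ↦ E[exp(-γ(πᵀ(S-p)+ℰ))]` is finite everywhere and has the unique global minimizer
`π̂ = (1/γ)(Mᵀ)⁻¹(Σ_H⁻¹μ_H - V̄ + (Σ_H⁻¹+M̄)M⁻¹(V-p))`. -/
theorem stmt_3 {Ω : Type*} [MeasurableSpace Ω] (P : Measure Ω) [IsProbabilityMeasure P]
    (d : ℕ) (H : Ω → Fin d → ℝ) (hH : Measurable H)
    (μH : Fin d → ℝ) (SH : Matrix (Fin d) (Fin d) ℝ) (hSH : SH.PosDef)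
    (hGauss : IsGaussianVec P H μH SH)
    (M : Matrix (Fin d) (Fin d) ℝ) (hM : IsUnit M.det) (V : Fin d → ℝ)
    (γ : ℝ) (hγ : 0 < γ)
    (Mb : Matrix (Fin d) (Fin d) ℝ) (hMbsymm : Mb.IsSymm) (hMbpd : (SH⁻¹ + Mb).PosDef)
    (Vb : Fin d → ℝ) (lb : ℝ) :
    ∀ p : Fin d → ℝ,
      (∀ π : Fin d → ℝ, Integrable (expDisutility H M V γ Mb Vb lb p π) P) ∧
      (∀ π : Fin d → ℝ,
        π ≠ (1 / γ) • (Mᵀ⁻¹ *ᵥ (SH⁻¹ *ᵥ μH - Vb + (SH⁻¹ + Mb) *ᵥ (M⁻¹ *ᵥ (V - p)))) →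
        ∫ ω, expDisutility H M V γ Mb Vb lb p
            ((1 / γ) • (Mᵀ⁻¹ *ᵥ (SH⁻¹ *ᵥ μH - Vb + (SH⁻¹ + Mb) *ᵥ (M⁻¹ *ᵥ (V - p))))) ω ∂P <
          ∫ ω, expDisutility H M V γ Mb Vb lb p π ω ∂P) := by
  intro p
  have hS : SH⁻¹.IsSymm := hSH.inv.isSymm
  have hA : (SH⁻¹ + Mb).IsSymm := hMbpd.isSymm
  have hAdet : IsUnit (SH⁻¹ + Mb).det := (isUnit_iff_isUnit_det _).1 hMbpd.isUnit
  have hMT : IsUnit Mᵀ.det := by rwa [det_transpose]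
  have hmeas := fun π => measurable_expDisutility_id M V Mb Vb lb p π γ
  set A := SH⁻¹ + Mb with hAdef
  set J : ℝ := ∫ x : Fin d → ℝ, Real.exp (-(1 / 2) * (x ⬝ᵥ (A *ᵥ x)))
  have hint := hMbpd.integrable_exp_neg_quadForm
  have hJ : 0 < J := integral_exp_pos hint
  have hc : 0 < (Real.sqrt ((2 * Real.pi) ^ d * SH.det))⁻¹ := by
    have := hSH.det_pos
    positivity
  have hval : ∀ π m : Fin d → ℝ, A *ᵥ m = SH⁻¹ *ᵥ μH - γ • (Mᵀ *ᵥ π) - Vb →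
      ∫ ω, expDisutility H M V γ Mb Vb lb p π ω ∂P =
        ((Real.sqrt ((2 * Real.pi) ^ d * SH.det))⁻¹ *
          Real.exp ((1 / 2) * (m ⬝ᵥ (A *ᵥ m)) - γ * (π ⬝ᵥ (V - p)) - lb
            - (1 / 2) * (μH ⬝ᵥ (SH⁻¹ *ᵥ μH)))) * J := by
    intro π m hm
    refine (hGauss.integral_comp_s3 hH (hmeas π)).trans ?_
    simp_rw [gaussianPdf_mul_expDisutility M V Mb Vb lb p π hγ.ne' hS hA hm]
    rw [integral_const_mul]
    congr 1
    exact integral_sub_right_eq_self (fun x => Real.exp (-(1 / 2) * (x ⬝ᵥ (A *ᵥ x)))) m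
  have hsol : ∀ π : Fin d → ℝ, ∃ m, A *ᵥ m = SH⁻¹ *ᵥ μH - γ • (Mᵀ *ᵥ π) - Vb := fun π =>
    ⟨A⁻¹ *ᵥ (SH⁻¹ *ᵥ μH - γ • (Mᵀ *ᵥ π) - Vb), by
      rw [mulVec_mulVec, mul_nonsing_inv _ hAdet, one_mulVec]⟩
  refine ⟨fun π => ?_, fun π hπ => ?_⟩
  · obtain ⟨m, hm⟩ := hsol π
    refine (hGauss.integrable_comp_iff_s3 hH (hmeas π)).2 ?_
    simp_rw [gaussianPdf_mul_expDisutility M V Mb Vb lb p π hγ.ne' hS hA hm]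
    exact (hint.comp_sub_right m).const_mul _
  · obtain ⟨m, hm⟩ := hsol π
    set πh := (1 / γ) • (Mᵀ⁻¹ *ᵥ (SH⁻¹ *ᵥ μH - Vb + A *ᵥ (M⁻¹ *ᵥ (V - p)))) with hπh
    set mh := -(M⁻¹ *ᵥ (V - p)) with hmh
    have hMmh : M *ᵥ mh = -(V - p) := by
      rw [hmh, mulVec_neg, mulVec_mulVec, mul_nonsing_inv _ hM, one_mulVec]
    have hm' : A *ᵥ mh = SH⁻¹ *ᵥ μH - γ • (Mᵀ *ᵥ πh) - Vb := by
      rw [hπh, mulVec_smul, mulVec_mulVec, mul_nonsing_inv _ hMT, one_mulVec, smul_smul,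
        mul_one_div_cancel hγ.ne', one_smul, hmh, mulVec_neg]
      abel
    rw [hval π m hm, hval πh mh hm']
    have hu : A *ᵥ (m - mh) = -(γ • (Mᵀ *ᵥ (π - πh))) := by
      rw [mulVec_sub, hm, hm', mulVec_sub, smul_sub]
      abel
    have hu0 : m - mh ≠ 0 := by
      intro h0
      rw [h0, mulVec_zero, eq_comm, neg_eq_zero, smul_eq_zero_iff_right hγ.ne'] at hu
      have h1 := congrArg (Mᵀ⁻¹ *ᵥ ·) hu
      simp only [mulVec_mulVec, nonsing_inv_mul _ hMT, one_mulVec, mulVec_zero] at h1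
      exact hπ (sub_eq_zero.1 h1)
    have hpos : 0 < (m - mh) ⬝ᵥ (A *ᵥ (m - mh)) := by
      simpa using hMbpd.dotProduct_mulVec_pos hu0
    have hcross : mh ⬝ᵥ (A *ᵥ (m - mh)) = γ * (π ⬝ᵥ (V - p) - πh ⬝ᵥ (V - p)) := by
      rw [hu, dotProduct_neg, dotProduct_smul, dotProduct_mulVec, vecMul_transpose, hMmh,
        neg_dotProduct, dotProduct_comm, sub_dotProduct, smul_eq_mul]
      ring
    rw [hA.quadForm_sub] at hpos
    rw [mulVec_sub, dotProduct_sub, hA.dotProduct_mulVec_comm mh m] at hcross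
    gcongr ?_ * Real.exp ?_ * _
    linarith
end

section
/- Let d ≥ 1 and let C_I, D_Z be symmetric positive definite d×d matrices. Let τ : [0,1] → [0,1] be continuous, strictly increasing, with τ(0) = 0, τ(1) = 1, continuously differentiable on [0,1) with τ̇ > 0 there. Let p, ω, γ : [0,1) → (0,∞) be continuous, let ω_0 ∈ (0,1) satisfy ∫_0^1 ω(τ(u)) du < 1 - ω_0, and set λ := p ω / γ. For N ≥ 1 and 1 ≤ n ≤ 2^N put r^N_n := (n-1) 2^{-N} (with r^N_{2^N+1} := 1), t^N_n := τ(r^N_n), C^N_n := p(t^N_n) C_I, D^N_n := (τ(r^N_{n+1}) - τ(r^N_n))⁻¹ D_Z, α^N_n := 2^{-N} ω(t^N_n)/γ(t^N_n) for n ≥ 2, and α^N_1 := ω^N_1 / γ(0) where ω^N_1 := 1 - ω_0 - 2^{-N} Σ_{n=2}^{2^N} ω(t^N_n); assume ω^N_1 > 0 for all large N and ω^N_1 → 1 - ω_0 - ∫_0^1 ω(τ(u)) du > 0. Define E^N_n := ( (C^N_n)⁻¹ + (α^N_n)^{-2} (C^N_n)⁻¹ (D^N_n)⁻¹ (C^N_n)⁻¹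 )⁻¹ and, for t ∈ [0,1), F^N_t := Σ_{n : t^N_n ≤ t} E^N_n. Then for each fixed t ∈ [0,1), lim_{N→∞} F^N_t = p(0) C_I + ( ∫_0^{τ^{-1}(t)} λ(τ(u))² / τ̇(u) du ) C_I D_Z C_I. -/
open MeasureTheory Matrix Filter

/-- The `n`-th private-signal time in the `N`-th market: `t^N_n = τ((n-1)/2^N)`. -/
noncomputable def tN (τ : ℝ → ℝ) (N n : ℕ) : ℝ := τ (((n : ℝ) - 1) / 2 ^ N)

/-- The weight `ω^N_1 = 1 - ω_0 - 2^{-N} Σ_{n=2}^{2^N} ω(t^N_n)` of the first insider. -/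
noncomputable def omega1 (τ ω : ℝ → ℝ) (ω0 : ℝ) (N : ℕ) : ℝ :=
  1 - ω0 - (∑ n ∈ Finset.Icc 2 (2 ^ N), ω (tN τ N n)) / 2 ^ N

/-- The precision-weighted risk tolerance `α^N_n` of the `n`-th insider:
`α^N_1 = ω^N_1/γ(0)` and `α^N_n = 2^{-N} ω(t^N_n)/γ(t^N_n)` for `n ≥ 2`. -/
noncomputable def alphaN (τ ω γ : ℝ → ℝ) (ω0 : ℝ) (N n : ℕ) : ℝ :=
  if n = 1 then omega1 τ ω ω0 N / γ 0 else (ω (tN τ N n) / γ (tN τ N n)) / 2 ^ N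

/-- The precision `E^N_n = ((C^N_n)⁻¹ + (α^N_n)⁻² (C^N_n)⁻¹ (D^N_n)⁻¹ (C^N_n)⁻¹)⁻¹` of the
`n`-th market signal, where `C^N_n = p(t^N_n) C_I` and
`D^N_n = (τ(r^N_{n+1}) - τ(r^N_n))⁻¹ D_Z`. -/
noncomputable def EN (d : ℕ) (CI DZ : Matrix (Fin d) (Fin d) ℝ) (τ p ω γ : ℝ → ℝ)
    (ω0 : ℝ) (N n : ℕ) : Matrix (Fin d) (Fin d) ℝ :=
  ((p (tN τ N n) • CI)⁻¹ +
    ((alphaN τ ω γ ω0 N n) ^ 2)⁻¹ •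
      ((p (tN τ N n) • CI)⁻¹ *
        ((τ ((n : ℝ) / 2 ^ N) - τ (((n : ℝ) - 1) / 2 ^ N))⁻¹ • DZ)⁻¹ *
        (p (tN τ N n) • CI)⁻¹))⁻¹

/-- The effective market precision at time `t` in the `N`-th market:
`F^N_t = Σ_{n : t^N_n ≤ t} E^N_n`. -/
noncomputable def FN (d : ℕ) (CI DZ : Matrix (Fin d) (Fin d) ℝ) (τ p ω γ : ℝ → ℝ)
    (ω0 : ℝ) (N : ℕ) (t : ℝ) : Matrix (Fin d) (Fin d) ℝ :=
  ∑ n ∈ (Finset.Icc 1 (2 ^ N)).filter fun n => tN τ N n ≤ t,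
    EN d CI DZ τ p ω γ ω0 N n

theorem tendsto_one_div_two_pow :
    Tendsto (fun N : ℕ => 1 / (2 : ℝ) ^ N) atTop (nhds 0) := by
  simpa [_root_.one_div_pow] using
    tendsto_pow_atTop_nhds_zero_of_lt_one (r := (1 / 2 : ℝ)) (by norm_num) (by norm_num)

/-- Right-endpoint Riemann sums over dyadic meshes, of functions converging uniformly to a
continuous function, converge to the integral of that function. -/
theorem tendsto_dyadic_riemannSum {s : ℝ} (hs : 0 ≤ s) {f : ℝ → ℝ}
    (hf : ContinuousOn f (Set.Icc 0 s)) {Φ : ℕ → ℝ → ℝ}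
    (hΦ : TendstoUniformlyOn Φ f atTop (Set.Icc 0 s)) :
    Tendsto (fun N : ℕ => ∑ i ∈ Finset.range ⌊s * 2 ^ N⌋₊, Φ N (((i : ℝ) + 1) / 2 ^ N) / 2 ^ N)
      atTop (nhds (∫ u in (0 : ℝ)..s, f u)) := by
  have hpow : Tendsto (fun N : ℕ => (2 : ℝ) ^ N) atTop atTop :=
    tendsto_pow_atTop_atTop_of_one_lt one_lt_two
  have hint : ∀ a ∈ Set.Icc 0 s, ∀ b ∈ Set.Icc 0 s, IntervalIntegrable f volume a b :=
    fun a ha b hb => (hf.mono (Set.uIcc_subset_Icc ha hb)).intervalIntegrable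
  have hfloor : Tendsto (fun N : ℕ => (⌊s * 2 ^ N⌋₊ : ℝ) / 2 ^ N) atTop (nhds s) :=
    (tendsto_nat_floor_mul_div_atTop hs).comp hpow
  have hmem : ∀ (N i : ℕ), i ≤ ⌊s * 2 ^ N⌋₊ → (i : ℝ) / 2 ^ N ∈ Set.Icc 0 s := by
    intro N i hi
    refine ⟨by positivity, ?_⟩
    rw [div_le_iff₀ (by positivity)]
    exact (Nat.le_floor_iff (by positivity)).1 hi
  have hprim : Tendsto (fun N : ℕ => ∫ u in (0 : ℝ)..(⌊s * 2 ^ N⌋₊ : ℝ) / 2 ^ N, f u) atTop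
      (nhds (∫ u in (0 : ℝ)..s, f u)) := by
    have hc : ContinuousOn (fun x => ∫ u in (0 : ℝ)..x, f u) (Set.Icc 0 s) := by
      have := intervalIntegral.continuousOn_primitive_interval (μ := volume) (f := f)
        (a := 0) (b := s) (by
          rw [Set.uIcc_of_le hs]; exact hf.integrableOn_Icc)
      rwa [Set.uIcc_of_le hs] at this
    exact (hc s ⟨hs, le_rfl⟩).tendsto.comp
      (tendsto_nhdsWithin_iff.2 ⟨hfloor, Eventually.of_forall fun N => hmem N _ le_rfl⟩)
  suffices h : Tendsto (fun N : ℕ =>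
      ∑ i ∈ Finset.range ⌊s * 2 ^ N⌋₊, Φ N (((i : ℝ) + 1) / 2 ^ N) / 2 ^ N -
        ∫ u in (0 : ℝ)..(⌊s * 2 ^ N⌋₊ : ℝ) / 2 ^ N, f u) atTop (nhds 0) by
    simpa using h.add hprim
  rw [Metric.tendsto_nhds]
  intro ε hε
  obtain ⟨η, hη, hηε⟩ : ∃ η : ℝ, 0 < η ∧ 2 * η * s < ε := by
    refine ⟨ε / (2 * (s + 1)), by positivity, ?_⟩
    have : 2 * (ε / (2 * (s + 1))) * s = ε * (s / (s + 1)) := by field_simp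
    rw [this]
    have h1 : s / (s + 1) < 1 := by rw [div_lt_one (by positivity)]; linarith
    nlinarith
  have huc := isCompact_Icc.uniformContinuousOn_of_continuous hf
  obtain ⟨δ, hδ, hδf⟩ := Metric.uniformContinuousOn_iff.1 huc η hη
  have hh := tendsto_one_div_two_pow
  filter_upwards [Metric.tendstoUniformlyOn_iff.1 hΦ η hη, hh.eventually_lt_const hδ]
    with N hN hNδ
  have hp : (0 : ℝ) < 2 ^ N := by positivity
  have hsum : ∫ u in (0 : ℝ)..(⌊s * 2 ^ N⌋₊ : ℝ) / 2 ^ N, f u =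
      ∑ i ∈ Finset.range ⌊s * 2 ^ N⌋₊,
        ∫ u in ((i : ℝ) / 2 ^ N)..(((i : ℝ) + 1) / 2 ^ N), f u := by
    have := intervalIntegral.sum_integral_adjacent_intervals (μ := volume) (f := f)
      (a := fun i : ℕ => (i : ℝ) / 2 ^ N) (n := ⌊s * 2 ^ N⌋₊)
      (fun i hi => hint _ (hmem N i hi.le) _ (hmem N (i + 1) hi))
    simpa using this.symm
  rw [hsum, ← Finset.sum_sub_distrib, Real.dist_eq, sub_zero]
  have hterm : ∀ i ∈ Finset.range ⌊s * 2 ^ N⌋₊,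
      |Φ N (((i : ℝ) + 1) / 2 ^ N) / 2 ^ N -
        ∫ u in ((i : ℝ) / 2 ^ N)..(((i : ℝ) + 1) / 2 ^ N), f u| ≤ 2 * η / 2 ^ N := by
    intro i hi
    rw [Finset.mem_range] at hi
    have ha := hmem N i hi.le
    have hb := hmem N (i + 1) hi
    push_cast at hb
    have hlen : ((i : ℝ) + 1) / 2 ^ N - (i : ℝ) / 2 ^ N = 1 / 2 ^ N := by ring
    have heq : Φ N (((i : ℝ) + 1) / 2 ^ N) / 2 ^ N -
        ∫ u in ((i : ℝ) / 2 ^ N)..(((i : ℝ) + 1) / 2 ^ N), f u =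
        ∫ u in ((i : ℝ) / 2 ^ N)..(((i : ℝ) + 1) / 2 ^ N),
          (Φ N (((i : ℝ) + 1) / 2 ^ N) - f u) := by
      rw [intervalIntegral.integral_sub intervalIntegrable_const (hint _ ha _ hb),
        intervalIntegral.integral_const, hlen, smul_eq_mul]
      ring
    rw [heq]
    have hbound := intervalIntegral.norm_integral_le_of_norm_le_const
      (a := (i : ℝ) / 2 ^ N) (b := ((i : ℝ) + 1) / 2 ^ N) (C := 2 * η)
      (f := fun u => Φ N (((i : ℝ) + 1) / 2 ^ N) - f u) (by
        intro u hu
        have hle : (i : ℝ) / 2 ^ N ≤ ((i : ℝ) + 1) / 2 ^ N := by gcongr; linarith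
        rw [Set.uIoc_of_le hle] at hu
        have hus : u ∈ Set.Icc 0 s := ⟨ha.1.trans hu.1.le, hu.2.trans hb.2⟩
        have h1 := hN _ hb
        have h2 := hδf _ hb _ hus (by
          rw [Real.dist_eq, abs_of_nonneg (by linarith [hu.2])]
          linarith [hu.1])
        rw [Real.dist_eq, abs_lt] at h1 h2
        rw [Real.norm_eq_abs, abs_le]
        constructor <;> linarith [h1.1, h1.2, h2.1, h2.2])
    rw [hlen, abs_of_pos (by positivity), Real.norm_eq_abs] at hbound
    calc _ ≤ _ := hbound
      _ = _ := by ring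
  calc _ ≤ _ := Finset.abs_sum_le_sum_abs _ _
    _ ≤ _ := Finset.sum_le_sum hterm
    _ = 2 * η * ((⌊s * 2 ^ N⌋₊ : ℝ) / 2 ^ N) := by
      rw [Finset.sum_const, Finset.card_range, nsmul_eq_mul]; ring
    _ ≤ 2 * η * s := by gcongr; exact (hmem N _ le_rfl).2
    _ < ε := hηε

/-- Joint convergence of forward difference quotients of a continuously differentiable function. -/
theorem tendsto_forward_slope {τ τ' : ℝ → ℝ}
    (hτd : ∀ u ∈ Set.Ico (0 : ℝ) 1, HasDerivAt τ (τ' u) u)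
    (hτ'c : ContinuousOn τ' (Set.Ico 0 1)) {s r₀ : ℝ} (hs : s < 1) (hr₀ : r₀ ∈ Set.Icc 0 s) :
    Tendsto (fun q : ℕ × ℝ => (τ (q.2 + 1 / 2 ^ q.1) - τ q.2) * 2 ^ q.1)
      (atTop ×ˢ nhdsWithin r₀ (Set.Icc 0 s)) (nhds (τ' r₀)) := by
  have hh := tendsto_one_div_two_pow
  rw [Metric.tendsto_nhds]
  intro ε hε
  obtain ⟨δ, hδ, hδτ⟩ := Metric.continuousWithinAt_iff.1 (hτ'c r₀ ⟨hr₀.1, hr₀.2.trans_lt hs⟩) ε hε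
  have e1 : ∀ᶠ N : ℕ in atTop, 1 / (2 : ℝ) ^ N < min (δ / 2) (1 - s) :=
    hh.eventually_lt_const (lt_min (by positivity) (by linarith))
  have e2 : ∀ᶠ r in nhdsWithin r₀ (Set.Icc 0 s), r ∈ Set.Icc 0 s ∧ dist r r₀ < δ / 2 :=
    (eventually_mem_nhdsWithin).and
      (mem_nhdsWithin_of_mem_nhds (Metric.ball_mem_nhds r₀ (by positivity)))
  filter_upwards [e1.prod_mk e2] with ⟨N, r⟩ ⟨h1, h2, h3⟩
  simp only at h1 h2 h3 ⊢
  have hp : (0 : ℝ) < 1 / 2 ^ N := by positivity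
  have h1a := h1.trans_le (min_le_left _ _)
  have h1b := h1.trans_le (min_le_right _ _)
  have hsub : ∀ x ∈ Set.Icc r (r + 1 / 2 ^ N), x ∈ Set.Ico (0 : ℝ) 1 := fun x hx =>
    ⟨h2.1.trans hx.1, by linarith [hx.2, h2.2]⟩
  obtain ⟨ξ, hξ, hξe⟩ := exists_hasDerivAt_eq_slope τ τ' (a := r) (b := r + 1 / 2 ^ N)
    (by linarith) (fun x hx => (hτd x (hsub x hx)).continuousAt.continuousWithinAt)
    (fun x hx => hτd x (hsub x (Set.Ioo_subset_Icc_self hx)))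
  have : (τ (r + 1 / 2 ^ N) - τ r) * 2 ^ N = τ' ξ := by
    rw [hξe, add_sub_cancel_left]; field_simp
  rw [this]
  refine hδτ (hsub ξ (Set.Ioo_subset_Icc_self hξ)) ?_
  rw [Real.dist_eq, abs_lt] at h3 ⊢
  constructor <;> linarith [hξ.1, hξ.2]

theorem Matrix.inv_smul_of_ne_zero {d : ℕ} {k : ℝ} (hk : k ≠ 0) {A : Matrix (Fin d) (Fin d) ℝ}
    (hA : IsUnit A.det) : (k • A)⁻¹ = k⁻¹ • A⁻¹ :=
  Matrix.inv_smul' A (Units.mk0 k hk) hA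

/-- Rescaling of the precision of a market signal, isolating its leading factor. -/
theorem signal_precision_eq {d : ℕ} {C D : Matrix (Fin d) (Fin d) ℝ} (hC : C.PosDef)
    (hD : D.PosDef) {a b δ : ℝ} (ha : 0 < a) (hb : 0 < b) (hδ : 0 < δ) :
    ((a • C)⁻¹ + (b ^ 2)⁻¹ • ((a • C)⁻¹ * (δ⁻¹ • D)⁻¹ * (a • C)⁻¹))⁻¹ =
      ((a * b) ^ 2 / δ) • ((C * D * C)⁻¹ + ((a * b ^ 2 / δ)) • C⁻¹)⁻¹ := by
  have hCu : IsUnit C.det := hC.det_pos.ne'.isUnit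
  have hDu : IsUnit D.det := hD.det_pos.ne'.isUnit
  have hX : ((C * D * C)⁻¹ + (a * b ^ 2 / δ) • C⁻¹).PosDef := by
    have h1 : (C * D * C).PosDef := by
      have := hD.conjTranspose_mul_mul_same (B := C) (Matrix.mulVec_injective_of_isUnit
        ((Matrix.isUnit_iff_isUnit_det _).2 hCu))
      rwa [hC.isHermitian.eq] at this
    exact h1.inv.add (hC.inv.smul (by positivity))
  rw [← inv_inv ((a * b) ^ 2 / δ), ← Matrix.inv_smul_of_ne_zero (by positivity)
    hX.det_pos.ne'.isUnit]
  congr 1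
  rw [Matrix.inv_smul_of_ne_zero ha.ne' hCu, Matrix.inv_smul_of_ne_zero (by positivity) hDu,
    Matrix.mul_inv_rev, Matrix.mul_inv_rev, smul_add, smul_smul]
  simp only [Matrix.smul_mul, Matrix.mul_smul, smul_smul, inv_inv, Matrix.mul_assoc]
  rw [add_comm]
  congr 2 <;> field_simp

theorem tendsto_matrix_inv {ι : Type*} {l : Filter ι} {d : ℕ}
    {A : ι → Matrix (Fin d) (Fin d) ℝ} {B : Matrix (Fin d) (Fin d) ℝ} (hB : IsUnit B.det)
    (h : Tendsto A l (nhds B)) : Tendsto (fun i => (A i)⁻¹) l (nhds B⁻¹) := by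
  have hc : ContinuousAt Ring.inverse B.det := by
    rw [Ring.inverse_eq_inv']
    exact continuousAt_inv₀ hB.ne_zero
  exact (continuousAt_matrix_inv B hc).tendsto.comp h

/-- The signal precision attached to the grid point `r` in the `N`-th market, when the risk
tolerance is the generic one. -/
noncomputable def gridPrecision {d : ℕ} (C D : Matrix (Fin d) (Fin d) ℝ) (τ p ω γ : ℝ → ℝ)
    (N : ℕ) (r : ℝ) : Matrix (Fin d) (Fin d) ℝ :=
  ((p (τ r) • C)⁻¹ + ((ω (τ r) / γ (τ r) / 2 ^ N) ^ 2)⁻¹ •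
    ((p (τ r) • C)⁻¹ * ((τ (r + 1 / 2 ^ N) - τ r)⁻¹ • D)⁻¹ * (p (τ r) • C)⁻¹))⁻¹

theorem EN_add_two {d : ℕ} (C D : Matrix (Fin d) (Fin d) ℝ) (τ p ω γ : ℝ → ℝ) (ω0 : ℝ)
    (N i : ℕ) :
    EN d C D τ p ω γ ω0 N (i + 2) = gridPrecision C D τ p ω γ N (((i : ℝ) + 1) / 2 ^ N) := by
  have h1 : (((i + 2 : ℕ) : ℝ) - 1) / 2 ^ N = ((i : ℝ) + 1) / 2 ^ N := by push_cast; ring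
  have h2 : ((i + 2 : ℕ) : ℝ) / 2 ^ N = ((i : ℝ) + 1) / 2 ^ N + 1 / 2 ^ N := by push_cast; ring
  have h3 : i + 2 ≠ 1 := by omega
  simp only [EN, gridPrecision, alphaN, tN, h1, h2, if_neg h3]

/-- Signal precisions, rescaled by the number of insiders, converge uniformly on compact
subintervals. -/
theorem tendstoUniformlyOn_gridPrecision {d : ℕ} {C D : Matrix (Fin d) (Fin d) ℝ}
    (hC : C.PosDef) (hD : D.PosDef) {τ τ' p ω γ : ℝ → ℝ}
    (hτmono : StrictMonoOn τ (Set.Icc 0 1))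
    (hτd : ∀ u ∈ Set.Ico (0 : ℝ) 1, HasDerivAt τ (τ' u) u)
    (hτ'c : ContinuousOn τ' (Set.Ico 0 1)) (hτ'pos : ∀ u ∈ Set.Ico (0 : ℝ) 1, 0 < τ' u)
    {s : ℝ} (hs : s < 1)
    (hpc : ContinuousOn (fun u => p (τ u)) (Set.Icc 0 s)) (hp : ∀ u ∈ Set.Icc 0 s, 0 < p (τ u))
    (hωc : ContinuousOn (fun u => ω (τ u)) (Set.Icc 0 s)) (hω : ∀ u ∈ Set.Icc 0 s, 0 < ω (τ u))
    (hγc : ContinuousOn (fun u => γ (τ u)) (Set.Icc 0 s)) (hγ : ∀ u ∈ Set.Icc 0 s, 0 < γ (τ u))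
    (j l : Fin d) :
    TendstoUniformlyOn (fun (N : ℕ) r => 2 ^ N * gridPrecision C D τ p ω γ N r j l)
      (fun r => (p (τ r) * ω (τ r) / γ (τ r)) ^ 2 / τ' r * (C * D * C) j l) atTop
      (Set.Icc 0 s) := by
  rw [← tendstoLocallyUniformlyOn_iff_tendstoUniformlyOn_of_compact isCompact_Icc,
    tendstoLocallyUniformlyOn_iff_filter]
  intro r₀ hr₀
  have hsub : ∀ u ∈ Set.Icc 0 s, u ∈ Set.Ico (0 : ℝ) 1 := fun u hu => ⟨hu.1, hu.2.trans_lt hs⟩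
  have hτ'₀ := (hτ'pos r₀ (hsub r₀ hr₀)).ne'
  have hγ₀ := (hγ r₀ hr₀).ne'
  have lift : ∀ {g : ℝ → ℝ}, ContinuousOn g (Set.Icc 0 s) →
      Tendsto (fun q : ℕ × ℝ => g q.2) (atTop ×ˢ nhdsWithin r₀ (Set.Icc 0 s)) (nhds (g r₀)) :=
    fun hg => (hg r₀ hr₀).tendsto.comp tendsto_snd
  have hq := tendsto_forward_slope hτd hτ'c hs hr₀
  have hinv : Tendsto (fun q : ℕ × ℝ => ((2 : ℝ) ^ q.1)⁻¹)
      (atTop ×ˢ nhdsWithin r₀ (Set.Icc 0 s)) (nhds 0) :=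
    (tendsto_pow_atTop_atTop_of_one_lt (r := (2 : ℝ)) one_lt_two).inv_tendsto_atTop.comp
      tendsto_fst
  have hlim : ContinuousOn
      (fun r => (p (τ r) * ω (τ r) / γ (τ r)) ^ 2 / τ' r * (C * D * C) j l) (Set.Icc 0 s) :=
    ((((hpc.mul hωc).div hγc fun u hu => (hγ u hu).ne').pow 2).div (hτ'c.mono hsub)
      fun u hu => (hτ'pos u (hsub u hu)).ne').mul continuousOn_const
  have hM : IsUnit (C * D * C).det := by
    rw [Matrix.det_mul, Matrix.det_mul]
    exact (mul_pos (mul_pos hC.det_pos hD.det_pos) hC.det_pos).ne'.isUnit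
  have hx : Tendsto (fun q : ℕ × ℝ => p (τ q.2) * (ω (τ q.2) / γ (τ q.2)) ^ 2 /
      ((τ (q.2 + 1 / 2 ^ q.1) - τ q.2) * 2 ^ q.1) * ((2 : ℝ) ^ q.1)⁻¹)
      (atTop ×ˢ nhdsWithin r₀ (Set.Icc 0 s)) (nhds 0) := by
    simpa using (((lift hpc).mul (((lift hωc).div (lift hγc) hγ₀).pow 2)).div hq hτ'₀).mul hinv
  have hG : Tendsto (fun q : ℕ × ℝ => ((C * D * C)⁻¹ + (p (τ q.2) * (ω (τ q.2) / γ (τ q.2)) ^ 2 /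
      ((τ (q.2 + 1 / 2 ^ q.1) - τ q.2) * 2 ^ q.1) * ((2 : ℝ) ^ q.1)⁻¹) • C⁻¹)⁻¹)
      (atTop ×ˢ nhdsWithin r₀ (Set.Icc 0 s)) (nhds (C * D * C)) := by
    have hinner := (tendsto_const_nhds (x := (C * D * C)⁻¹)).add (hx.smul_const C⁻¹)
    rw [zero_smul, add_zero] at hinner
    have := tendsto_matrix_inv (Matrix.isUnit_nonsing_inv_det _ hM) hinner
    rwa [Matrix.nonsing_inv_nonsing_inv _ hM] at this
  have hGjl := ((continuous_apply_apply j l).tendsto (C * D * C)).comp hG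
  have hmain := ((((lift hpc).mul (lift hωc)).div (lift hγc) hγ₀).pow 2 |>.div hq hτ'₀).mul hGjl
  rw [tendstoUniformlyOnFilter_iff_tendsto]
  refine Tendsto.mono_right (Tendsto.prodMk_nhds (lift hlim) (hmain.congr' ?_))
    (nhds_le_uniformity _)
  have hh := tendsto_one_div_two_pow
  filter_upwards [(hh.eventually_lt_const (sub_pos.2 hs)).prod_mk
    (eventually_mem_nhdsWithin (a := r₀) (s := Set.Icc 0 s))] with ⟨N, r⟩ ⟨hN, hr⟩
  simp only at hN hr ⊢
  have hpow : (0 : ℝ) < 1 / 2 ^ N := by positivity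
  have hδ : 0 < τ (r + 1 / 2 ^ N) - τ r := sub_pos.2 <| hτmono
    ⟨hr.1, hr.2.trans hs.le⟩ ⟨by linarith [hr.1], by linarith [hr.2]⟩ (by linarith)
  have hp' := hp r hr
  have hω' := hω r hr
  have hγ' := hγ r hr
  rw [gridPrecision, signal_precision_eq hC hD hp' (by positivity) hδ]
  have e : p (τ r) * (ω (τ r) / γ (τ r)) ^ 2 / ((τ (r + 1 / 2 ^ N) - τ r) * 2 ^ N) *
      ((2 : ℝ) ^ N)⁻¹ =
      p (τ r) * (ω (τ r) / γ (τ r) / 2 ^ N) ^ 2 / (τ (r + 1 / 2 ^ N) - τ r) := by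
    generalize τ (r + 1 / 2 ^ N) - τ r = δ at hδ ⊢
    field_simp
  simp only [Function.comp, Pi.div_apply, e, Matrix.smul_apply, smul_eq_mul]
  rw [← mul_assoc]
  congr 1
  generalize τ (r + 1 / 2 ^ N) - τ r = δ at hδ ⊢
  field_simp

theorem tendsto_EN_one {d : ℕ} {C D : Matrix (Fin d) (Fin d) ℝ}
    (hC : C.PosDef) (hD : D.PosDef) {τ p ω γ : ℝ → ℝ} {ω0 L : ℝ}
    (hτc : ContinuousOn τ (Set.Icc 0 1)) (hτmono : StrictMonoOn τ (Set.Icc 0 1)) (hτ0 : τ 0 = 0)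
    (hp : 0 < p 0) (hγ : 0 < γ 0) (hL : 0 < L)
    (hω1 : Tendsto (omega1 τ ω ω0) atTop (nhds L)) :
    Tendsto (fun N => EN d C D τ p ω γ ω0 N 1) atTop (nhds (p 0 • C)) := by
  have hCu : IsUnit C.det := hC.det_pos.ne'.isUnit
  have hDu : IsUnit D.det := hD.det_pos.ne'.isUnit
  have hpC : IsUnit (p 0 • C).det := (hC.smul hp).det_pos.ne'.isUnit
  have hh := tendsto_one_div_two_pow
  have hmem : ∀ N : ℕ, 1 / (2 : ℝ) ^ N ∈ Set.Icc (0 : ℝ) 1 := fun N =>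
    ⟨by positivity, div_le_one_of_le₀ (one_le_pow₀ one_le_two) (by positivity)⟩
  have hτh : Tendsto (fun N : ℕ => τ (1 / (2 : ℝ) ^ N)) atTop (nhds 0) := by
    have := (hτc 0 (by simp)).tendsto.comp
      (tendsto_nhdsWithin_iff.2 ⟨hh, Eventually.of_forall hmem⟩)
    rwa [hτ0] at this
  have hα : Tendsto (fun N => ((omega1 τ ω ω0 N / γ 0) ^ 2)⁻¹ * τ (1 / 2 ^ N)) atTop (nhds 0) := by
    have := (((hω1.div_const (γ 0)).pow 2).inv₀ (by positivity)).mul hτh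
    simpa using this
  have hinner : Tendsto (fun N => (p 0 • C)⁻¹ + (((omega1 τ ω ω0 N / γ 0) ^ 2)⁻¹ *
      τ (1 / 2 ^ N)) • ((p 0 • C)⁻¹ * D⁻¹ * (p 0 • C)⁻¹)) atTop (nhds (p 0 • C)⁻¹) := by
    simpa using (tendsto_const_nhds (x := (p 0 • C)⁻¹)).add
      (hα.smul_const ((p 0 • C)⁻¹ * D⁻¹ * (p 0 • C)⁻¹))
  have := tendsto_matrix_inv (Matrix.isUnit_nonsing_inv_det _ hpC) hinner
  rw [Matrix.nonsing_inv_nonsing_inv _ hpC] at this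
  refine this.congr fun N => ?_
  have hτpos : 0 < τ (1 / 2 ^ N) := by
    have := hτmono ⟨le_rfl, zero_le_one⟩ (hmem N) (by positivity)
    rwa [hτ0] at this
  have ht : tN τ N 1 = 0 := by simp [tN, hτ0]
  simp only [EN, alphaN, ht, if_true, Nat.cast_one, sub_self, zero_div, hτ0, sub_zero]
  rw [Matrix.inv_smul_of_ne_zero (k := (τ (1 / 2 ^ N))⁻¹) (by positivity) hDu, inv_inv,
    Matrix.mul_smul, Matrix.smul_mul, smul_smul]

theorem FN_eq_add_sum {d : ℕ} (C D : Matrix (Fin d) (Fin d) ℝ) {τ : ℝ → ℝ} (p ω γ : ℝ → ℝ)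
    (ω0 : ℝ) (hτmono : StrictMonoOn τ (Set.Icc 0 1)) {s : ℝ} (hs : s ∈ Set.Ico (0 : ℝ) 1)
    (N : ℕ) :
    FN d C D τ p ω γ ω0 N (τ s) = EN d C D τ p ω γ ω0 N 1 +
      ∑ i ∈ Finset.range ⌊s * 2 ^ N⌋₊, gridPrecision C D τ p ω γ N (((i : ℝ) + 1) / 2 ^ N) := by
  have hp : (0 : ℝ) < 2 ^ N := by positivity
  have hs0 : 0 ≤ s * 2 ^ N := mul_nonneg hs.1 hp.le
  have hlt : ⌊s * 2 ^ N⌋₊ < 2 ^ N := by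
    rw [Nat.floor_lt hs0]
    push_cast
    nlinarith [hs.2]
  have hset : ((Finset.Icc 1 (2 ^ N)).filter fun n => tN τ N n ≤ τ s) =
      (Finset.range (⌊s * 2 ^ N⌋₊ + 1)).image (· + 1) := by
    ext n
    rw [Finset.mem_filter, Finset.mem_Icc]
    simp only [Finset.mem_image, Finset.mem_range, tN]
    have key : ∀ m : ℕ, m < 2 ^ N →
        (τ ((((m + 1 : ℕ) : ℝ) - 1) / 2 ^ N) ≤ τ s ↔ m < ⌊s * 2 ^ N⌋₊ + 1) := by
      intro m hm
      have hm' : (m : ℝ) < 2 ^ N := by exact_mod_cast hm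
      rw [Nat.cast_succ, add_sub_cancel_right, hτmono.le_iff_le
        ⟨by positivity, div_le_one_of_le₀ hm'.le hp.le⟩ ⟨hs.1, hs.2.le⟩, div_le_iff₀ hp,
        Nat.lt_succ_iff, Nat.le_floor_iff hs0]
    constructor
    · rintro ⟨⟨h1, h2⟩, h3⟩
      obtain ⟨m, rfl⟩ := Nat.exists_eq_add_of_le' h1
      exact ⟨m, (key m (by omega)).1 h3, rfl⟩
    · rintro ⟨m, hm, rfl⟩
      exact ⟨⟨by omega, by omega⟩, (key m (by omega)).2 hm⟩
  rw [FN, hset, Finset.sum_image (fun a _ b _ h => Nat.succ_injective h),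
    Finset.sum_range_succ', add_comm]
  congr 1
  exact Finset.sum_congr rfl fun i _ => EN_add_two C D τ p ω γ ω0 N i

/-- Convergence of the effective market precision: for each fixed `t ∈ [0,1)`,
`F^N_t → p(0) C_I + (∫_0^{τ⁻¹(t)} λ(τ(u))²/τ̇(u) du) C_I D_Z C_I` as `N → ∞`, where
`λ = pω/γ` and `s = τ⁻¹(t)`. -/
theorem stmt_16 (d : ℕ) (hd : 1 ≤ d)
    (CI DZ : Matrix (Fin d) (Fin d) ℝ) (hCI : CI.PosDef) (hDZ : DZ.PosDef)
    (τ τ' : ℝ → ℝ)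
    (hτc : ContinuousOn τ (Set.Icc 0 1)) (hτmono : StrictMonoOn τ (Set.Icc 0 1))
    (hτ0 : τ 0 = 0) (hτ1 : τ 1 = 1)
    (hτd : ∀ u ∈ Set.Ico (0 : ℝ) 1, HasDerivAt τ (τ' u) u)
    (hτ'c : ContinuousOn τ' (Set.Ico 0 1))
    (hτ'pos : ∀ u ∈ Set.Ico (0 : ℝ) 1, 0 < τ' u)
    (p ω γ : ℝ → ℝ)
    (hpc : ContinuousOn p (Set.Ico 0 1)) (hppos : ∀ t ∈ Set.Ico (0 : ℝ) 1, 0 < p t)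
    (hωc : ContinuousOn ω (Set.Ico 0 1)) (hωpos : ∀ t ∈ Set.Ico (0 : ℝ) 1, 0 < ω t)
    (hγc : ContinuousOn γ (Set.Ico 0 1)) (hγpos : ∀ t ∈ Set.Ico (0 : ℝ) 1, 0 < γ t)
    (ω0 : ℝ) (hω0 : ω0 ∈ Set.Ioo (0 : ℝ) 1)
    (hωint : (∫ u in (0 : ℝ)..1, ω (τ u)) < 1 - ω0)
    (hω1pos : ∀ᶠ N in atTop, 0 < omega1 τ ω ω0 N)
    (hω1lim : Tendsto (omega1 τ ω ω0) atTop
      (nhds (1 - ω0 - ∫ u in (0 : ℝ)..1, ω (τ u))))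
    (t s : ℝ) (ht : t ∈ Set.Ico (0 : ℝ) 1) (hs : s ∈ Set.Ico (0 : ℝ) 1) (hst : τ s = t) :
    Tendsto (fun N => FN d CI DZ τ p ω γ ω0 N t) atTop
      (nhds (p 0 • CI +
        (∫ u in (0 : ℝ)..s, (p (τ u) * ω (τ u) / γ (τ u)) ^ 2 / τ' u) •
          (CI * DZ * CI))) := by
  subst hst
  have hτmem : ∀ u ∈ Set.Icc 0 s, τ u ∈ Set.Ico (0 : ℝ) 1 := by
    intro u hu
    have hu1 : u ∈ Set.Icc (0 : ℝ) 1 := ⟨hu.1, hu.2.trans hs.2.le⟩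
    refine ⟨?_, ?_⟩
    · rw [← hτ0]
      exact hτmono.monotoneOn (by simp) hu1 hu.1
    · rw [← hτ1]
      exact hτmono hu1 (by simp) (hu.2.trans_lt hs.2)
  have hsub : Set.Icc 0 s ⊆ Set.Ico (0 : ℝ) 1 := fun u hu => ⟨hu.1, hu.2.trans_lt hs.2⟩
  have hτs : ContinuousOn τ (Set.Icc 0 s) := hτc.mono (hsub.trans Set.Ico_subset_Icc_self)
  have hp := hpc.comp hτs hτmem
  have hω := hωc.comp hτs hτmem
  have hγ := hγc.comp hτs hτmem
  have h0 : (0 : ℝ) ∈ Set.Ico (0 : ℝ) 1 := by simp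
  simp only [FN_eq_add_sum CI DZ p ω γ ω0 hτmono hs]
  refine (tendsto_EN_one hCI hDZ hτc hτmono hτ0 (hppos 0 h0) (hγpos 0 h0)
    (by linarith) hω1lim).add ?_
  refine tendsto_pi_nhds.2 fun j => tendsto_pi_nhds.2 fun l => ?_
  have hf : ContinuousOn
      (fun r => (p (τ r) * ω (τ r) / γ (τ r)) ^ 2 / τ' r * (CI * DZ * CI) j l) (Set.Icc 0 s) :=
    ((((hp.mul hω).div hγ fun u hu => (hγpos _ (hτmem u hu)).ne').pow 2).div (hτ'c.mono hsub)
      fun u hu => (hτ'pos u (hsub hu)).ne').mul continuousOn_const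
  have := tendsto_dyadic_riemannSum hs.1 hf
    (tendstoUniformlyOn_gridPrecision hCI hDZ hτmono hτd hτ'c hτ'pos hs.2
      hp (fun u hu => hppos _ (hτmem u hu)) hω (fun u hu => hωpos _ (hτmem u hu))
      hγ (fun u hu => hγpos _ (hτmem u hu)) j l)
  rw [intervalIntegral.integral_mul_const] at this
  refine this.congr fun N => ?_
  rw [Matrix.sum_apply]
  exact Finset.sum_congr rfl fun i _ => mul_div_cancel_left₀ _ (by positivity)
end

section
/- Let a ∈ ℝ and for t ∈ [0,1) define g(t) := ∫_0^t (1-u)^{-2a} du, and define Q := ∫_0^1 g(t) / (1 + (1-t) g(t)) dt. Then the two conditions ( lim_{t→1⁻} g(t) = ∞ and Q < ∞ ) hold simultaneously if and only if 1/2 ≤ a < 1. -/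
open MeasureTheory Filter

theorem intervalIntegrable_one_sub_rpow (r : ℝ) {s t : ℝ} (hs : s < 1) (ht : t < 1) :
    IntervalIntegrable (fun u : ℝ => (1 - u) ^ r) volume s t := by
  apply ContinuousOn.intervalIntegrable
  intro u hu
  have hu1 : u < 1 := hu.2.trans_lt (max_lt hs ht)
  refine ContinuousAt.continuousWithinAt ?_
  exact (continuousAt_const.sub continuousAt_id).rpow_const (Or.inl (by simp; linarith))

theorem integral_one_sub_rpow {r t : ℝ} (hr : r ≠ -1) (ht : t < 1) :
    ∫ u in (0 : ℝ)..t, (1 - u) ^ r = (1 - (1 - t) ^ (r + 1)) / (r + 1) := by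
  rw [intervalIntegral.integral_comp_sub_left (fun x : ℝ => x ^ r) 1, integral_rpow]
  · simp
  · refine Or.inr ⟨hr, fun h => ?_⟩
    have := (lt_min (by linarith) (by simp) : (0 : ℝ) < min (1 - t) (1 - 0)).trans_le h.1
    exact lt_irrefl _ this

theorem integral_one_sub_rpow_neg_one {t : ℝ} (ht : t < 1) :
    ∫ u in (0 : ℝ)..t, (1 - u) ^ (-1 : ℝ) = -Real.log (1 - t) := by
  simp_rw [Real.rpow_neg_one]
  rw [intervalIntegral.integral_comp_sub_left (fun x : ℝ => x⁻¹) 1,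
    integral_inv_of_pos (by linarith) (by simp)]
  simp

theorem integral_one_sub_rpow_anti {r s t : ℝ} (hrs : r ≤ s) (ht0 : 0 ≤ t) (ht : t < 1) :
    ∫ u in (0 : ℝ)..t, (1 - u) ^ s ≤ ∫ u in (0 : ℝ)..t, (1 - u) ^ r := by
  refine intervalIntegral.integral_mono_on ht0
    (intervalIntegrable_one_sub_rpow s one_pos ht)
    (intervalIntegrable_one_sub_rpow r one_pos ht) fun u hu => ?_
  exact Real.rpow_le_rpow_of_exponent_ge (by linarith [hu.2]) (by linarith [hu.1]) hrs

theorem integral_one_sub_rpow_nonneg (r : ℝ) {t : ℝ} (ht0 : 0 ≤ t) (ht : t < 1) :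
    0 ≤ ∫ u in (0 : ℝ)..t, (1 - u) ^ r :=
  intervalIntegral.integral_nonneg ht0 fun u hu => Real.rpow_nonneg (by linarith [hu.2]) _

theorem monotoneOn_integral_one_sub_rpow (r : ℝ) :
    MonotoneOn (fun t : ℝ => ∫ u in (0 : ℝ)..t, (1 - u) ^ r) (Set.Ioo 0 1) := by
  intro s hs t ht hst
  have h := intervalIntegral.integral_add_adjacent_intervals
    (intervalIntegrable_one_sub_rpow r one_pos hs.2)
    (intervalIntegrable_one_sub_rpow r hs.2 ht.2)
  have h' : 0 ≤ ∫ u in s..t, (1 - u) ^ r :=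
    intervalIntegral.integral_nonneg hst fun u hu =>
      Real.rpow_nonneg (by linarith [hu.2, ht.2]) _
  simp only
  linarith

theorem Ioo_zero_one_mem_nhdsWithin : Set.Ioo (0 : ℝ) 1 ∈ nhdsWithin (1 : ℝ) (Set.Iio 1) :=
  Ioo_mem_nhdsLT one_pos

theorem not_tendsto_integral_one_sub_rpow {r : ℝ} (hr : -1 < r) :
    ¬ Tendsto (fun t : ℝ => ∫ u in (0 : ℝ)..t, (1 - u) ^ r)
      (nhdsWithin 1 (Set.Iio 1)) atTop := by
  intro h
  obtain ⟨t, h1, ht⟩ := ((h.eventually_gt_atTop (1 / (r + 1))).and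
    Ioo_zero_one_mem_nhdsWithin).exists
  rw [integral_one_sub_rpow hr.ne' ht.2] at h1
  refine absurd h1 (not_lt.2 ?_)
  have := Real.rpow_nonneg (by linarith [ht.2] : 0 ≤ 1 - t) (r + 1)
  exact div_le_div_of_nonneg_right (by linarith) (by linarith)

theorem tendsto_integral_one_sub_rpow {r : ℝ} (hr : r ≤ -1) :
    Tendsto (fun t : ℝ => ∫ u in (0 : ℝ)..t, (1 - u) ^ r)
      (nhdsWithin 1 (Set.Iio 1)) atTop := by
  have hsub : Tendsto (fun t : ℝ => 1 - t) (nhdsWithin 1 (Set.Iio 1))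
      (nhdsWithin 0 (Set.Ioi 0)) := by
    refine tendsto_nhdsWithin_iff.2 ⟨?_, ?_⟩
    · have : Tendsto (fun t : ℝ => 1 - t) (nhds 1) (nhds (1 - 1)) :=
        tendsto_const_nhds.sub tendsto_id
      rw [sub_self] at this
      exact this.mono_left nhdsWithin_le_nhds
    · filter_upwards [self_mem_nhdsWithin] with t ht
      exact sub_pos.2 (Set.mem_Iio.1 ht)
  refine tendsto_atTop_mono' _ ?_
    (tendsto_neg_atBot_atTop.comp (Real.tendsto_log_nhdsGT_zero.comp hsub))
  filter_upwards [Ioo_zero_one_mem_nhdsWithin] with t ht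
  have := integral_one_sub_rpow_anti hr ht.1.le ht.2
  rwa [integral_one_sub_rpow_neg_one ht.2] at this

theorem integrableOn_drift {a : ℝ} (ha0 : 0 < a) (ha : a < 1) :
    IntegrableOn
      (fun t : ℝ => (∫ u in (0 : ℝ)..t, (1 - u) ^ (-(2 * a))) /
        (1 + (1 - t) * ∫ u in (0 : ℝ)..t, (1 - u) ^ (-(2 * a))))
      (Set.Ioo 0 1) volume := by
  have hdom : IntegrableOn (fun t : ℝ => (1 - t) ^ (-a) / a) (Set.Ioo 0 1) volume := by
    have h := (intervalIntegral.intervalIntegrable_rpow' (a := 0) (b := 1)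
      (by linarith : -1 < -a)).comp_sub_left 1
    rw [sub_zero, sub_self] at h
    have h2 := h.symm.div_const a
    rwa [intervalIntegrable_iff_integrableOn_Ioo_of_le zero_le_one] at h2
  have hmeas := aemeasurable_restrict_of_monotoneOn (μ := volume) measurableSet_Ioo
    (monotoneOn_integral_one_sub_rpow (-(2 * a)))
  refine Integrable.mono' hdom ?_ ?_
  · exact (hmeas.div (aemeasurable_const.add
      ((measurable_const.sub measurable_id).aemeasurable.mul hmeas))).aestronglyMeasurable
  · filter_upwards [ae_restrict_mem measurableSet_Ioo] with t ht
    have hg := integral_one_sub_rpow_nonneg (-(2 * a)) ht.1.le ht.2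
    have hle := integral_one_sub_rpow_anti (by linarith : -(a + 1) ≤ -(2 * a)) ht.1.le ht.2
    rw [integral_one_sub_rpow (r := -(a + 1)) (fun h => by linarith) ht.2] at hle
    have hd : 1 ≤ 1 + (1 - t) * ∫ u in (0 : ℝ)..t, (1 - u) ^ (-(2 * a)) :=
      le_add_of_nonneg_right (mul_nonneg (by linarith [ht.2]) hg)
    rw [Real.norm_of_nonneg (div_nonneg hg (by linarith))]
    refine (div_le_self hg hd).trans (hle.trans ?_)
    rw [show -(a + 1) + 1 = -a by ring, div_neg, ← neg_div]
    exact div_le_div_of_nonneg_right (by linarith) ha0.le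

theorem not_integrableOn_drift {a : ℝ} (ha : 1 ≤ a) :
    ¬ IntegrableOn
      (fun t : ℝ => (∫ u in (0 : ℝ)..t, (1 - u) ^ (-(2 * a))) /
        (1 + (1 - t) * ∫ u in (0 : ℝ)..t, (1 - u) ^ (-(2 * a))))
      (Set.Ioo 0 1) volume := by
  intro h
  have hdom : IntegrableOn (fun t : ℝ => 1 + 2 * ((∫ u in (0 : ℝ)..t, (1 - u) ^ (-(2 * a))) /
        (1 + (1 - t) * ∫ u in (0 : ℝ)..t, (1 - u) ^ (-(2 * a)))))
      (Set.Ioo 0 1) volume :=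
    Integrable.add (integrableOn_const (by simp)) (Integrable.const_mul h 2)
  have hinv : IntegrableOn (fun t : ℝ => (t - 1)⁻¹) (Set.Ioo 0 1) volume := by
    refine Integrable.mono' hdom
      (measurable_id.sub measurable_const).inv.aestronglyMeasurable ?_
    filter_upwards [ae_restrict_mem measurableSet_Ioo] with t ht
    have hs : 0 < 1 - t := by linarith [ht.2]
    have hle := integral_one_sub_rpow_anti (by linarith : -(2 * a) ≤ -2) ht.1.le ht.2
    rw [integral_one_sub_rpow (by norm_num) ht.2, show (-2 : ℝ) + 1 = -1 by norm_num,
      Real.rpow_neg_one] at hle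
    have hg := integral_one_sub_rpow_nonneg (-(2 * a)) ht.1.le ht.2
    generalize (∫ u in (0 : ℝ)..t, (1 - u) ^ (-(2 * a))) = g at hle hg ⊢
    have hmul : t ≤ (1 - t) * g := by
      have := mul_le_mul_of_nonneg_left hle hs.le
      have h1 : (1 - t) * ((1 - (1 - t)⁻¹) / -1) = t := by field_simp; ring
      linarith
    rw [norm_inv, Real.norm_eq_abs, abs_sub_comm, abs_of_pos hs]
    have hd : 0 < 1 + (1 - t) * g := by nlinarith [ht.1]
    rw [← sub_nonneg]
    have key : 1 + 2 * (g / (1 + (1 - t) * g)) - (1 - t)⁻¹ =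
        ((1 - t) * g * (1 + (1 - t)) - t) / ((1 - t) * (1 + (1 - t) * g)) := by
      field_simp; ring
    rw [key]
    refine div_nonneg ?_ (mul_pos hs hd).le
    nlinarith [ht.1]
  rw [← intervalIntegrable_iff_integrableOn_Ioo_of_le zero_le_one,
    intervalIntegrable_sub_inv_iff] at hinv
  simp at hinv

/-- The equally-spaced case with `λ(t) = (1-t)^{-a}`: with
`g(t) = ∫_0^t (1-u)^{-2a} du` and `Q = ∫_0^1 g(t)/(1 + (1-t) g(t)) dt`, the two conditions
`lim_{t→1⁻} g(t) = ∞` and `Q < ∞` hold simultaneously if and only if `1/2 ≤ a < 1`. -/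
theorem stmt_17 (a : ℝ) :
    (Tendsto (fun t : ℝ => ∫ u in (0 : ℝ)..t, (1 - u) ^ (-(2 * a)))
        (nhdsWithin 1 (Set.Iio 1)) atTop ∧
      IntegrableOn
        (fun t : ℝ => (∫ u in (0 : ℝ)..t, (1 - u) ^ (-(2 * a))) /
          (1 + (1 - t) * ∫ u in (0 : ℝ)..t, (1 - u) ^ (-(2 * a))))
        (Set.Ioo 0 1) volume) ↔
      (1 / 2 ≤ a ∧ a < 1) := by
  constructor
  · rintro ⟨hlim, hint⟩
    constructor
    · by_contra! h
      exact not_tendsto_integral_one_sub_rpow (by linarith) hlim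
    · by_contra! h
      exact not_integrableOn_drift h hint
  · rintro ⟨h1, h2⟩
    exact ⟨tendsto_integral_one_sub_rpow (by linarith), integrableOn_drift (by linarith) h2⟩
end
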